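/- The su_q^P(3) coproduct respects the mixed root brackets: as functions on ℝ⁹×ℝ⁹ one has {Δ(a₁₃), Δ(a₂₁)} = −cosh(z((h₁+h₁')−(h₂+h₂')))·Δ(a₂₃), {Δ(a₁₃), Δ(a₃₂)} = cosh(z((h₂+h₂')−(h₃+h₃')))·Δ(a₁₂), {Δ(a₁₂), Δ(a₃₁)} = −cosh(z((h₁+h₁')−(h₂+h₂')))·Δ(a₃₂), and {Δ(a₂₃), Δ(a₃₁)} = cosh(z((h₂+h₂')−(h₃+h₃')))·Δ(a₂₁), where the brackets on the left are the product Poisson bracket. -/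

import Mathlib

/-- Partial derivative of a function on ℝ⁹ in the `i`-th coordinate direction.
Coordinates: (x 0,…,x 8) = (h₁,h₂,h₃,a₁₂,a₂₁,a₂₃,a₃₂,a₁₃,a₃₁). -/
noncomputable def pd (i : Fin 9) (f : (Fin 9 → ℝ) → ℝ) (x : Fin 9 → ℝ) : ℝ :=
  fderiv ℝ f x (Pi.single i 1)

/-- The structure functions π(u,v) of su_q^P(3) for u < v (zero otherwise);
indices: 0=h₁, 1=h₂, 2=h₃, 3=a₁₂, 4=a₂₁, 5=a₂₃, 6=a₃₂, 7=a₁₃, 8=a₃₁. -/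
noncomputable def piU (z : ℝ) (u v : ℕ) (x : Fin 9 → ℝ) : ℝ :=
  match u, v with
  | 0, 3 => x 3
  | 0, 4 => -x 4
  | 0, 7 => x 7
  | 0, 8 => -x 8
  | 1, 3 => -x 3
  | 1, 4 => x 4
  | 1, 5 => x 5
  | 1, 6 => -x 6
  | 2, 5 => -x 5
  | 2, 6 => x 6
  | 2, 7 => -x 7
  | 2, 8 => x 8
  | 3, 4 => Real.sinh (z * (x 0 - x 1)) / z
  | 3, 5 => x 7
  | 3, 7 => z ^ 2 * x 3 ^ 2 * x 5
  | 3, 8 => -(Real.cosh (z * (x 0 - x 1)) * x 6)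
  | 4, 6 => -x 8
  | 4, 7 => Real.cosh (z * (x 0 - x 1)) * x 5
  | 4, 8 => -(z ^ 2 * x 4 ^ 2 * x 6)
  | 5, 6 => Real.sinh (z * (x 1 - x 2)) / z
  | 5, 7 => -(z ^ 2 * x 5 ^ 2 * x 3)
  | 5, 8 => Real.cosh (z * (x 1 - x 2)) * x 4
  | 6, 7 => -(Real.cosh (z * (x 1 - x 2)) * x 3)
  | 6, 8 => z ^ 2 * x 6 ^ 2 * x 4
  | 7, 8 => Real.sinh (z * (x 0 - x 2)) / z
      + z * Real.sinh (z * (x 0 - x 1)) * x 5 * x 6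
      + z * Real.sinh (z * (x 1 - x 2)) * x 3 * x 4
  | _, _ => 0

/-- The bracket of the q-Poisson algebra su_q^P(3):
{f,g} = Σ_{u<v} π(u,v)(∂_u f ∂_v g − ∂_v f ∂_u g). -/
noncomputable def suq3Bracket (z : ℝ) (f g : (Fin 9 → ℝ) → ℝ) (x : Fin 9 → ℝ) : ℝ :=
  ∑ u : Fin 9, ∑ v : Fin 9,
    if u < v then piU z u.val v.val x * (pd u f x * pd v g x - pd v f x * pd u g x)
    else 0

/-- The product Poisson bracket on ℝ⁹ × ℝ⁹. -/
noncomputable def suq3Bracket2 (z : ℝ) (F G : (Fin 9 → ℝ) × (Fin 9 → ℝ) → ℝ)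
    (p : (Fin 9 → ℝ) × (Fin 9 → ℝ)) : ℝ :=
  suq3Bracket z (fun y => F (y, p.2)) (fun y => G (y, p.2)) p.1
  + suq3Bracket z (fun y => F (p.1, y)) (fun y => G (p.1, y)) p.2

/-- Coproduct Δ(hᵢ) = hᵢ + hᵢ' (i = 0,1,2 standing for 1,2,3). -/
noncomputable def Dh (i : Fin 3) : (Fin 9 → ℝ) × (Fin 9 → ℝ) → ℝ := fun p =>
  p.1 ⟨i.val, by omega⟩ + p.2 ⟨i.val, by omega⟩

/-- Coproduct Δ(a₁₂). -/
noncomputable def Da12 (z : ℝ) : (Fin 9 → ℝ) × (Fin 9 → ℝ) → ℝ := fun p =>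
  Real.exp (z * (p.1 0 - p.1 1) / 2) * p.2 3
  + p.1 3 * Real.exp (-(z * (p.2 0 - p.2 1) / 2))

/-- Coproduct Δ(a₂₁). -/
noncomputable def Da21 (z : ℝ) : (Fin 9 → ℝ) × (Fin 9 → ℝ) → ℝ := fun p =>
  Real.exp (z * (p.1 0 - p.1 1) / 2) * p.2 4
  + p.1 4 * Real.exp (-(z * (p.2 0 - p.2 1) / 2))

/-- Coproduct Δ(a₂₃). -/
noncomputable def Da23 (z : ℝ) : (Fin 9 → ℝ) × (Fin 9 → ℝ) → ℝ := fun p =>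
  Real.exp (z * (p.1 1 - p.1 2) / 2) * p.2 5
  + p.1 5 * Real.exp (-(z * (p.2 1 - p.2 2) / 2))

/-- Coproduct Δ(a₃₂). -/
noncomputable def Da32 (z : ℝ) : (Fin 9 → ℝ) × (Fin 9 → ℝ) → ℝ := fun p =>
  Real.exp (z * (p.1 1 - p.1 2) / 2) * p.2 6
  + p.1 6 * Real.exp (-(z * (p.2 1 - p.2 2) / 2))

/-- Coproduct Δ(a₁₃). -/
noncomputable def Da13 (z : ℝ) : (Fin 9 → ℝ) × (Fin 9 → ℝ) → ℝ := fun p =>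
  Real.exp (z * (p.1 0 - p.1 2) / 2) * p.2 7
  + p.1 7 * Real.exp (-(z * (p.2 0 - p.2 2) / 2))
  + z * (Real.exp (z * (p.1 1 - p.1 2) / 2) * p.1 3
           * (Real.exp (-(z * (p.2 0 - p.2 1) / 2)) * p.2 5)
         - Real.exp (z * (p.1 0 - p.1 1) / 2) * p.1 5
           * (Real.exp (-(z * (p.2 1 - p.2 2) / 2)) * p.2 3))

/-- Coproduct Δ(a₃₁). -/
noncomputable def Da31 (z : ℝ) : (Fin 9 → ℝ) × (Fin 9 → ℝ) → ℝ := fun p =>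
  Real.exp (z * (p.1 0 - p.1 2) / 2) * p.2 8
  + p.1 8 * Real.exp (-(z * (p.2 0 - p.2 2) / 2))
  + z * (Real.exp (z * (p.1 1 - p.1 2) / 2) * p.1 4
           * (Real.exp (-(z * (p.2 0 - p.2 1) / 2)) * p.2 6)
         - Real.exp (z * (p.1 0 - p.1 1) / 2) * p.1 6
           * (Real.exp (-(z * (p.2 1 - p.2 2) / 2)) * p.2 4))

/-- The Kronecker delta, as a real number. -/
noncomputable def kron (j i : Fin 9) : ℝ := if j = i then 1 else 0

lemma pd_add {f g : (Fin 9 → ℝ) → ℝ} {x : Fin 9 → ℝ} (i : Fin 9)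
    (hf : DifferentiableAt ℝ f x) (hg : DifferentiableAt ℝ g x) :
    pd i (fun y => f y + g y) x = pd i f x + pd i g x := by
  simp [pd, fderiv_fun_add hf hg]

lemma pd_sub {f g : (Fin 9 → ℝ) → ℝ} {x : Fin 9 → ℝ} (i : Fin 9)
    (hf : DifferentiableAt ℝ f x) (hg : DifferentiableAt ℝ g x) :
    pd i (fun y => f y - g y) x = pd i f x - pd i g x := by
  simp [pd, fderiv_fun_sub hf hg]

lemma pd_mul {f g : (Fin 9 → ℝ) → ℝ} {x : Fin 9 → ℝ} (i : Fin 9)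
    (hf : DifferentiableAt ℝ f x) (hg : DifferentiableAt ℝ g x) :
    pd i (fun y => f y * g y) x = f x * pd i g x + g x * pd i f x := by
  simp [pd, fderiv_fun_mul hf hg]

lemma pd_const (i : Fin 9) (c : ℝ) (x : Fin 9 → ℝ) : pd i (fun _ => c) x = 0 := by
  simp [pd]

lemma pd_coord (i j : Fin 9) (x : Fin 9 → ℝ) :
    pd i (fun y => y j) x = kron j i := by
  simp [pd, kron, (hasFDerivAt_apply (𝕜 := ℝ) j x).fderiv, Pi.single_apply]

lemma pd_exp_half (i j k : Fin 9) (z : ℝ) (x : Fin 9 → ℝ) :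
    pd i (fun y => Real.exp (z * (y j - y k) / 2)) x
      = z / 2 * (kron j i - kron k i)
        * Real.exp (z * (x j - x k) / 2) := by
  have h := ((((hasFDerivAt_apply (𝕜 := ℝ) j x).sub
    (hasFDerivAt_apply (𝕜 := ℝ) k x)).const_mul (z / 2))).exp
  have e : (fun y : Fin 9 → ℝ => Real.exp (z * (y j - y k) / 2))
      = fun y => Real.exp (z / 2 * (y j - y k)) := by
    funext y; ring_nf
  rw [pd, e, HasFDerivAt.fderiv (f := fun y : Fin 9 → ℝ => Real.exp (z / 2 * (y j - y k))) h]
  simp [kron, Pi.single_apply]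
  ring_nf

lemma pd_exp_neg_half (i j k : Fin 9) (z : ℝ) (x : Fin 9 → ℝ) :
    pd i (fun y => Real.exp (-(z * (y j - y k) / 2))) x
      = -(z / 2) * (kron j i - kron k i)
        * Real.exp (-(z * (x j - x k) / 2)) := by
  convert pd_exp_half i j k (-z) x using 2 <;> ring_nf

lemma pd_Da12_fst (z : ℝ) (x q : Fin 9 → ℝ) (i : Fin 9) :
    pd i (fun y => Da12 z (y, q)) x =
      z / 2 * (kron 0 i - kron 1 i) * Real.exp (z * (x 0 - x 1) / 2) * q 3
      + kron 3 i * Real.exp (-(z * (q 0 - q 1) / 2)) := by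
  simp (disch := fun_prop) only [Da12, pd_add, pd_mul, pd_const, pd_coord, pd_exp_half]
  ring

lemma pd_Da12_snd (z : ℝ) (x q : Fin 9 → ℝ) (i : Fin 9) :
    pd i (fun y => Da12 z (q, y)) x =
      Real.exp (z * (q 0 - q 1) / 2) * kron 3 i
      + q 3 * (-(z / 2) * (kron 0 i - kron 1 i) * Real.exp (-(z * (x 0 - x 1) / 2))) := by
  simp (disch := fun_prop) only [Da12, pd_add, pd_mul, pd_const, pd_coord, pd_exp_neg_half]
  ring

lemma pd_Da21_fst (z : ℝ) (x q : Fin 9 → ℝ) (i : Fin 9) :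
    pd i (fun y => Da21 z (y, q)) x =
      z / 2 * (kron 0 i - kron 1 i) * Real.exp (z * (x 0 - x 1) / 2) * q 4
      + kron 4 i * Real.exp (-(z * (q 0 - q 1) / 2)) := by
  simp (disch := fun_prop) only [Da21, pd_add, pd_mul, pd_const, pd_coord, pd_exp_half]
  ring

lemma pd_Da21_snd (z : ℝ) (x q : Fin 9 → ℝ) (i : Fin 9) :
    pd i (fun y => Da21 z (q, y)) x =
      Real.exp (z * (q 0 - q 1) / 2) * kron 4 i
      + q 4 * (-(z / 2) * (kron 0 i - kron 1 i) * Real.exp (-(z * (x 0 - x 1) / 2))) := by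
  simp (disch := fun_prop) only [Da21, pd_add, pd_mul, pd_const, pd_coord, pd_exp_neg_half]
  ring

lemma pd_Da23_fst (z : ℝ) (x q : Fin 9 → ℝ) (i : Fin 9) :
    pd i (fun y => Da23 z (y, q)) x =
      z / 2 * (kron 1 i - kron 2 i) * Real.exp (z * (x 1 - x 2) / 2) * q 5
      + kron 5 i * Real.exp (-(z * (q 1 - q 2) / 2)) := by
  simp (disch := fun_prop) only [Da23, pd_add, pd_mul, pd_const, pd_coord, pd_exp_half]
  ring

lemma pd_Da23_snd (z : ℝ) (x q : Fin 9 → ℝ) (i : Fin 9) :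
    pd i (fun y => Da23 z (q, y)) x =
      Real.exp (z * (q 1 - q 2) / 2) * kron 5 i
      + q 5 * (-(z / 2) * (kron 1 i - kron 2 i) * Real.exp (-(z * (x 1 - x 2) / 2))) := by
  simp (disch := fun_prop) only [Da23, pd_add, pd_mul, pd_const, pd_coord, pd_exp_neg_half]
  ring

lemma pd_Da32_fst (z : ℝ) (x q : Fin 9 → ℝ) (i : Fin 9) :
    pd i (fun y => Da32 z (y, q)) x =
      z / 2 * (kron 1 i - kron 2 i) * Real.exp (z * (x 1 - x 2) / 2) * q 6
      + kron 6 i * Real.exp (-(z * (q 1 - q 2) / 2)) := by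
  simp (disch := fun_prop) only [Da32, pd_add, pd_mul, pd_const, pd_coord, pd_exp_half]
  ring

lemma pd_Da32_snd (z : ℝ) (x q : Fin 9 → ℝ) (i : Fin 9) :
    pd i (fun y => Da32 z (q, y)) x =
      Real.exp (z * (q 1 - q 2) / 2) * kron 6 i
      + q 6 * (-(z / 2) * (kron 1 i - kron 2 i) * Real.exp (-(z * (x 1 - x 2) / 2))) := by
  simp (disch := fun_prop) only [Da32, pd_add, pd_mul, pd_const, pd_coord, pd_exp_neg_half]
  ring

lemma pd_Da13_fst (z : ℝ) (x q : Fin 9 → ℝ) (i : Fin 9) :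
    pd i (fun y => Da13 z (y, q)) x =
      z / 2 * (kron 0 i - kron 2 i) * Real.exp (z * (x 0 - x 2) / 2) * q 7
      + kron 7 i * Real.exp (-(z * (q 0 - q 2) / 2))
      + z * ((kron 3 i + z / 2 * (kron 1 i - kron 2 i) * x 3)
            * Real.exp (z * (x 1 - x 2) / 2) * Real.exp (-(z * (q 0 - q 1) / 2)) * q 5
          - (kron 5 i + z / 2 * (kron 0 i - kron 1 i) * x 5)
            * Real.exp (z * (x 0 - x 1) / 2) * Real.exp (-(z * (q 1 - q 2) / 2)) * q 3) := by
  simp (disch := fun_prop) only [Da13, pd_add, pd_sub, pd_mul, pd_const, pd_coord, pd_exp_half]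
  ring

lemma pd_Da13_snd (z : ℝ) (x q : Fin 9 → ℝ) (i : Fin 9) :
    pd i (fun y => Da13 z (q, y)) x =
      Real.exp (z * (q 0 - q 2) / 2) * kron 7 i
      + q 7 * (-(z / 2) * (kron 0 i - kron 2 i) * Real.exp (-(z * (x 0 - x 2) / 2)))
      + z * (Real.exp (z * (q 1 - q 2) / 2) * q 3
            * ((kron 5 i + -(z / 2) * (kron 0 i - kron 1 i) * x 5)
                * Real.exp (-(z * (x 0 - x 1) / 2)))
          - Real.exp (z * (q 0 - q 1) / 2) * q 5
            * ((kron 3 i + -(z / 2) * (kron 1 i - kron 2 i) * x 3)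
                * Real.exp (-(z * (x 1 - x 2) / 2)))) := by
  simp (disch := fun_prop) only [Da13, pd_add, pd_sub, pd_mul, pd_const, pd_coord, pd_exp_neg_half]
  ring

lemma pd_Da31_fst (z : ℝ) (x q : Fin 9 → ℝ) (i : Fin 9) :
    pd i (fun y => Da31 z (y, q)) x =
      z / 2 * (kron 0 i - kron 2 i) * Real.exp (z * (x 0 - x 2) / 2) * q 8
      + kron 8 i * Real.exp (-(z * (q 0 - q 2) / 2))
      + z * ((kron 4 i + z / 2 * (kron 1 i - kron 2 i) * x 4)
            * Real.exp (z * (x 1 - x 2) / 2) * Real.exp (-(z * (q 0 - q 1) / 2)) * q 6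
          - (kron 6 i + z / 2 * (kron 0 i - kron 1 i) * x 6)
            * Real.exp (z * (x 0 - x 1) / 2) * Real.exp (-(z * (q 1 - q 2) / 2)) * q 4) := by
  simp (disch := fun_prop) only [Da31, pd_add, pd_sub, pd_mul, pd_const, pd_coord, pd_exp_half]
  ring

lemma pd_Da31_snd (z : ℝ) (x q : Fin 9 → ℝ) (i : Fin 9) :
    pd i (fun y => Da31 z (q, y)) x =
      Real.exp (z * (q 0 - q 2) / 2) * kron 8 i
      + q 8 * (-(z / 2) * (kron 0 i - kron 2 i) * Real.exp (-(z * (x 0 - x 2) / 2)))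
      + z * (Real.exp (z * (q 1 - q 2) / 2) * q 4
            * ((kron 6 i + -(z / 2) * (kron 0 i - kron 1 i) * x 6)
                * Real.exp (-(z * (x 0 - x 1) / 2)))
          - Real.exp (z * (q 0 - q 1) / 2) * q 6
            * ((kron 4 i + -(z / 2) * (kron 1 i - kron 2 i) * x 4)
                * Real.exp (-(z * (x 1 - x 2) / 2)))) := by
  simp (disch := fun_prop) only [Da31, pd_add, pd_sub, pd_mul, pd_const, pd_coord, pd_exp_neg_half]
  ring

/-- The bracket written out over the nonzero structure functions. -/
lemma suq3Bracket_eq (z : ℝ) (f g : (Fin 9 → ℝ) → ℝ) (x : Fin 9 → ℝ) :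
    suq3Bracket z f g x =
      (fun w : Fin 9 → Fin 9 → ℝ =>
      x 3 * w 0 3 - x 4 * w 0 4 + x 7 * w 0 7 - x 8 * w 0 8
      - x 3 * w 1 3 + x 4 * w 1 4 + x 5 * w 1 5 - x 6 * w 1 6
      - x 5 * w 2 5 + x 6 * w 2 6 - x 7 * w 2 7 + x 8 * w 2 8
      + Real.sinh (z * (x 0 - x 1)) / z * w 3 4 + x 7 * w 3 5
      + z ^ 2 * x 3 ^ 2 * x 5 * w 3 7 - Real.cosh (z * (x 0 - x 1)) * x 6 * w 3 8
      - x 8 * w 4 6 + Real.cosh (z * (x 0 - x 1)) * x 5 * w 4 7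
      - z ^ 2 * x 4 ^ 2 * x 6 * w 4 8
      + Real.sinh (z * (x 1 - x 2)) / z * w 5 6 - z ^ 2 * x 5 ^ 2 * x 3 * w 5 7
      + Real.cosh (z * (x 1 - x 2)) * x 4 * w 5 8
      - Real.cosh (z * (x 1 - x 2)) * x 3 * w 6 7 + z ^ 2 * x 6 ^ 2 * x 4 * w 6 8
      + (Real.sinh (z * (x 0 - x 2)) / z + z * Real.sinh (z * (x 0 - x 1)) * x 5 * x 6
        + z * Real.sinh (z * (x 1 - x 2)) * x 3 * x 4) * w 7 8)
      (fun u v => pd u f x * pd v g x - pd v f x * pd u g x) := by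
  generalize h : (fun u v : Fin 9 => pd u f x * pd v g x - pd v f x * pd u g x) = w
  have hw : ∀ u v, pd u f x * pd v g x - pd v f x * pd u g x = w u v :=
    fun u v => congrFun (congrFun h u) v
  simp only [suq3Bracket, hw]
  simp [Fin.sum_univ_succ, piU]
  ring

lemma exp_half_sub (z a b : ℝ) :
    Real.exp (z * (a - b) / 2) = Real.exp (z * a / 2) / Real.exp (z * b / 2) := by
  rw [← Real.exp_sub]; ring_nf

lemma exp_neg_half_sub (z a b : ℝ) :
    Real.exp (-(z * (a - b) / 2)) = Real.exp (z * b / 2) / Real.exp (z * a / 2) := by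
  rw [← Real.exp_sub]; ring_nf

lemma exp_mul_sub (z a b : ℝ) :
    Real.exp (z * (a - b)) = (Real.exp (z * a / 2) / Real.exp (z * b / 2)) ^ 2 := by
  rw [← Real.exp_sub, ← Real.exp_nat_mul]; ring_nf

lemma cosh_mul_sub (z a b : ℝ) :
    Real.cosh (z * (a - b)) = ((Real.exp (z * a / 2) / Real.exp (z * b / 2)) ^ 2
      + (Real.exp (z * b / 2) / Real.exp (z * a / 2)) ^ 2) / 2 := by
  rw [Real.cosh_eq, ← mul_neg, neg_sub, exp_mul_sub, exp_mul_sub]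

lemma sinh_mul_sub (z a b : ℝ) :
    Real.sinh (z * (a - b)) = ((Real.exp (z * a / 2) / Real.exp (z * b / 2)) ^ 2
      - (Real.exp (z * b / 2) / Real.exp (z * a / 2)) ^ 2) / 2 := by
  rw [Real.sinh_eq, ← mul_neg, neg_sub, exp_mul_sub, exp_mul_sub]

lemma exp_half_add (z a b : ℝ) :
    Real.exp (z * (a + b) / 2) = Real.exp (z * a / 2) * Real.exp (z * b / 2) := by
  rw [← Real.exp_add]; ring_nf

/-- the su_q^P(3) coproduct respects the mixed root brackets. -/
theorem suq3_coproduct_mixed (z : ℝ) (hz : z ≠ 0) :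
    (∀ p : (Fin 9 → ℝ) × (Fin 9 → ℝ),
      suq3Bracket2 z (Da13 z) (Da21 z) p
        = -(Real.cosh (z * ((p.1 0 + p.2 0) - (p.1 1 + p.2 1))) * Da23 z p)) ∧
    (∀ p : (Fin 9 → ℝ) × (Fin 9 → ℝ),
      suq3Bracket2 z (Da13 z) (Da32 z) p
        = Real.cosh (z * ((p.1 1 + p.2 1) - (p.1 2 + p.2 2))) * Da12 z p) ∧
    (∀ p : (Fin 9 → ℝ) × (Fin 9 → ℝ),
      suq3Bracket2 z (Da12 z) (Da31 z) p
        = -(Real.cosh (z * ((p.1 0 + p.2 0) - (p.1 1 + p.2 1))) * Da32 z p)) ∧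
    (∀ p : (Fin 9 → ℝ) × (Fin 9 → ℝ),
      suq3Bracket2 z (Da23 z) (Da31 z) p
        = Real.cosh (z * ((p.1 1 + p.2 1) - (p.1 2 + p.2 2))) * Da21 z p) := by
  refine ⟨fun p => ?_, fun p => ?_, fun p => ?_, fun p => ?_⟩
  all_goals
    simp only [suq3Bracket2, suq3Bracket_eq, pd_Da12_fst, pd_Da12_snd, pd_Da21_fst, pd_Da21_snd,
      pd_Da23_fst, pd_Da23_snd, pd_Da32_fst, pd_Da32_snd, pd_Da13_fst, pd_Da13_snd,
      pd_Da31_fst, pd_Da31_snd]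
    simp only [kron, Fin.reduceEq, if_true, if_false, mul_zero, zero_mul, add_zero, zero_add,
      sub_zero, zero_sub, mul_one, one_mul, sub_self]
    simp only [Da12, Da21, Da23, Da32]
    simp only [exp_half_sub, exp_neg_half_sub, cosh_mul_sub, sinh_mul_sub, exp_half_add]
    have ne : ∀ a, Real.exp (z * a / 2) ≠ 0 := fun a => Real.exp_ne_zero _
    have h0 := ne (p.1 0)
    have h1 := ne (p.1 1)
    have h2 := ne (p.1 2)
    have k0 := ne (p.2 0)
    have k1 := ne (p.2 1)
    have k2 := ne (p.2 2)
    clear ne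
    generalize Real.exp (z * p.1 0 / 2) = A0 at *
    generalize Real.exp (z * p.1 1 / 2) = A1 at *
    generalize Real.exp (z * p.1 2 / 2) = A2 at *
    generalize Real.exp (z * p.2 0 / 2) = B0 at *
    generalize Real.exp (z * p.2 1 / 2) = B1 at *
    generalize Real.exp (z * p.2 2 / 2) = B2 at *
    field_simp
    ring
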